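/- Let Σ(t), for t in a neighborhood of 0 in [0,∞)ⁿ, be a continuous family of symmetric positive definite real d×d matrices with Σ = Σ(0), admitting the expansion Σ − Σ(t) = Σᵢ[(A_{1,i} + A_{1,i}ᵀ)tᵢ^{β′ᵢ} + (A_{2,i} + A_{2,i}ᵀ)tᵢ^{βᵢ}] + Σ_{i,j∈F} A_{6,i,j}tᵢ^{βᵢ/2}tⱼ^{βⱼ/2} + o(Σᵢ tᵢ^{βᵢ}) as t ↓ 0, where 0 < β′ < β ≤ 2β′ componentwise and F = {i : 2β′ᵢ = βᵢ}. Let b ∈ ℝ^d have at least one positive component, let b(t) denote the solution of Π_{Σ(t)}(b), set w = Σ⁻¹b(0), and assume A_{1,i}w = 0 for all i and b(t) − b(0) = o(Σᵢ tᵢ^{β′ᵢ}) as t ↓ 0. Then the generalized variance σ_b^{−2}(t) = min_{x ≥ b} xᵀΣ(t)⁻¹x satisfies σ_b^{−2}(t) − σ_b^{−2}(0) = Σ_{i,j=1}^n Ξ_{i,j}·tᵢ^{βᵢ/2}tⱼ^{βⱼ/2} + o(Σᵢ tᵢ^{βᵢ}) as t ↓ 0, where Ξ_{i,j} = wᵀ[2A_{2,i}·1_{i=j}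 + (A_{6,i,j} + A_{1,i}Σ⁻¹A_{1,j}ᵀ)·1_{i,j∈F}]w. -/

import Mathlib

open Real Matrix

open Filter Asymptotics Topology

/-- The box neighbourhoods `[0, δ)ⁿ` form a basis of the neighbourhoods of `0` in the orthant. -/
theorem eventually_nhdsWithin_orthant_iff {n : ℕ} {P : (Fin n → ℝ) → Prop} :
    (∀ᶠ t in 𝓝[{t | ∀ i, 0 ≤ t i}] (0 : Fin n → ℝ), P t) ↔
      ∃ δ > (0 : ℝ), ∀ t : Fin n → ℝ, (∀ i, 0 ≤ t i) → (∀ i, t i < δ) → P t := by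
  rw [eventually_nhdsWithin_iff, Metric.eventually_nhds_iff]
  constructor
  · rintro ⟨δ, hδ, h⟩
    refine ⟨δ, hδ, fun t h0 h1 => h ?_ h0⟩
    rw [dist_pi_lt_iff hδ]
    intro i
    simpa [abs_of_nonneg (h0 i)] using h1 i
  · rintro ⟨δ, hδ, h⟩
    refine ⟨δ, hδ, fun t ht h0 => h t h0 fun i => ?_⟩
    rw [dist_pi_lt_iff hδ] at ht
    simpa [abs_of_nonneg (h0 i)] using ht i

section BilinearAsymptotics

variable {α ι κ : Type*} [Fintype ι] {l : Filter α}

theorem isBigO_dotProduct {f g : α → ι → ℝ} {a c : α → ℝ}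
    (hf : ∀ i, (fun t => f t i) =O[l] a) (hg : ∀ i, (fun t => g t i) =O[l] c) :
    (fun t => f t ⬝ᵥ g t) =O[l] fun t => a t * c t :=
  IsBigO.fun_sum fun i _ => (hf i).mul (hg i)

theorem isLittleO_dotProduct_left {f g : α → ι → ℝ} {a c : α → ℝ}
    (hf : ∀ i, (fun t => f t i) =o[l] a) (hg : ∀ i, (fun t => g t i) =O[l] c) :
    (fun t => f t ⬝ᵥ g t) =o[l] fun t => a t * c t :=
  IsLittleO.fun_sum fun i _ => (hf i).mul_isBigO (hg i)

theorem isLittleO_dotProduct_right {f g : α → ι → ℝ} {a c : α → ℝ}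
    (hf : ∀ i, (fun t => f t i) =O[l] a) (hg : ∀ i, (fun t => g t i) =o[l] c) :
    (fun t => f t ⬝ᵥ g t) =o[l] fun t => a t * c t :=
  IsLittleO.fun_sum fun i _ => (hf i).mul_isLittleO (hg i)

theorem isBigO_mulVec {M : α → Matrix κ ι ℝ} {f : α → ι → ℝ} {c : α → ℝ}
    (hM : ∀ p q, (fun t => M t p q) =O[l] fun _ => (1 : ℝ))
    (hf : ∀ i, (fun t => f t i) =O[l] c) (p : κ) :
    (fun t => (M t *ᵥ f t) p) =O[l] c := by
  simpa only [one_mul, mulVec] using isBigO_dotProduct (hM p) hf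

theorem isLittleO_mulVec_of_left {M : α → Matrix κ ι ℝ} {f : α → ι → ℝ} {c : α → ℝ}
    (hM : ∀ p q, (fun t => M t p q) =o[l] fun _ => (1 : ℝ))
    (hf : ∀ i, (fun t => f t i) =O[l] c) (p : κ) :
    (fun t => (M t *ᵥ f t) p) =o[l] c := by
  simpa only [one_mul, mulVec] using isLittleO_dotProduct_left (hM p) hf

theorem isLittleO_mulVec_of_right {M : α → Matrix κ ι ℝ} {f : α → ι → ℝ} {c : α → ℝ}
    (hM : ∀ p q, (fun t => M t p q) =O[l] fun _ => (1 : ℝ))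
    (hf : ∀ i, (fun t => f t i) =o[l] c) (p : κ) :
    (fun t => (M t *ᵥ f t) p) =o[l] c := by
  simpa only [one_mul, mulVec] using isLittleO_dotProduct_right (hM p) hf

end BilinearAsymptotics

section Quadratic

variable {ι : Type*}

theorem Matrix.PosDef.isSymm_real {M : Matrix ι ι ℝ} (hM : M.PosDef) : M.IsSymm := by
  simpa [IsSymm, IsHermitian, conjTranspose_eq_transpose_of_trivial] using hM.isHermitian

variable [Fintype ι]

theorem Matrix.IsSymm.dotProduct_mulVec_comm {M : Matrix ι ι ℝ} (hM : M.IsSymm)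
    (x y : ι → ℝ) : x ⬝ᵥ (M *ᵥ y) = y ⬝ᵥ (M *ᵥ x) := by
  rw [dotProduct_mulVec, dotProduct_comm, ← mulVec_transpose, hM.eq]

/-- First order optimality condition for `min_{x ≥ b} xᵀMx` with `M` symmetric. -/
theorem dotProduct_mulVec_sub_nonneg_of_isMin {M : Matrix ι ι ℝ} (hM : M.IsSymm)
    {b x₀ : ι → ℝ} (h₀ : b ≤ x₀)
    (hmin : ∀ x, b ≤ x → x₀ ⬝ᵥ (M *ᵥ x₀) ≤ x ⬝ᵥ (M *ᵥ x)) {x : ι → ℝ} (hx : b ≤ x) :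
    0 ≤ (x - x₀) ⬝ᵥ (M *ᵥ x₀) := by
  set e := x - x₀ with he
  have key : ∀ s : ℝ, 0 ≤ s → s ≤ 1 →
      0 ≤ s * (2 * (e ⬝ᵥ (M *ᵥ x₀)) + s * (e ⬝ᵥ (M *ᵥ e))) := by
    intro s hs hs1
    have hfeas : b ≤ x₀ + s • e := by
      intro i
      have h1 := h₀ i
      have h2 := hx i
      simp only [he, Pi.add_apply, Pi.smul_apply, Pi.sub_apply, smul_eq_mul]
      nlinarith
    have h := hmin _ hfeas
    simp only [mulVec_add, mulVec_smul, dotProduct_add, add_dotProduct, smul_dotProduct,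
      dotProduct_smul, smul_eq_mul, hM.dotProduct_mulVec_comm x₀ e] at h
    linarith
  by_contra! hneg
  set c := e ⬝ᵥ (M *ᵥ x₀)
  set q := e ⬝ᵥ (M *ᵥ e)
  have hq : 0 < |q| - c := by linarith [abs_nonneg q]
  have hs0 : 0 < -c / (|q| - c) := div_pos (by linarith) hq
  have hs1 : -c / (|q| - c) ≤ 1 := (div_le_one hq).2 (by linarith [abs_nonneg q])
  have h := nonneg_of_mul_nonneg_right (key _ hs0.le hs1) hs0
  have h3 : -c / (|q| - c) * q ≤ -c := by
    calc -c / (|q| - c) * q ≤ -c / (|q| - c) * (|q| - c) := by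
          gcongr; linarith [le_abs_self q]
      _ = -c := by field_simp
  linarith

variable [DecidableEq ι]

theorem Matrix.PosDef.dotProduct_inv_mulVec_nonneg {M : Matrix ι ι ℝ} (hM : M.PosDef)
    (x : ι → ℝ) : 0 ≤ x ⬝ᵥ (M⁻¹ *ᵥ x) := by
  simpa using hM.inv.posSemidef.dotProduct_mulVec_nonneg x

/-- Second order resolvent expansion of the quadratic form `x₀ᵀT⁻¹x₀` around `x₀ᵀS⁻¹x₀`. -/
theorem dotProduct_inv_mulVec_eq_add {S T : Matrix ι ι ℝ} (hS : S.PosDef) (hT : T.PosDef)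
    (x₀ w : ι → ℝ) (hw : w = S⁻¹ *ᵥ x₀) :
    T⁻¹ *ᵥ x₀ = w + T⁻¹ *ᵥ ((S - T) *ᵥ w) ∧
    x₀ ⬝ᵥ (T⁻¹ *ᵥ x₀) = x₀ ⬝ᵥ (S⁻¹ *ᵥ x₀) + w ⬝ᵥ ((S - T) *ᵥ w)
      + ((S - T) *ᵥ w) ⬝ᵥ (T⁻¹ *ᵥ ((S - T) *ᵥ w)) := by
  have hSu : IsUnit S.det := (isUnit_iff_isUnit_det S).1 hS.isUnit
  have hTu : IsUnit T.det := (isUnit_iff_isUnit_det T).1 hT.isUnit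
  have hx₀ : x₀ = T *ᵥ w + (S - T) *ᵥ w := by
    rw [← add_mulVec, add_sub_cancel, hw, mulVec_mulVec, mul_nonsing_inv _ hSu, one_mulVec]
  set z := (S - T) *ᵥ w
  have h1 : T⁻¹ *ᵥ x₀ = w + T⁻¹ *ᵥ z := by
    rw [hx₀, mulVec_add, mulVec_mulVec, nonsing_inv_mul _ hTu, one_mulVec]
  refine ⟨h1, ?_⟩
  have h2 : (T *ᵥ w) ⬝ᵥ (T⁻¹ *ᵥ z) = w ⬝ᵥ z := by
    rw [dotProduct_comm, hT.isSymm_real.dotProduct_mulVec_comm, mulVec_mulVec,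
      mul_nonsing_inv _ hTu, one_mulVec]
  rw [h1, ← hw, dotProduct_add, add_assoc]
  congr 1
  conv_lhs => rw [hx₀]
  rw [add_dotProduct, h2]

end Quadratic

/-- Expansion of the generalized variance
`σ_b^{−2}(t) = min_{x ≥ b} xᵀΣ(t)⁻¹x`: under the second-order expansion of `Σ(t)` with
matrices `A_{1,i}, A_{2,i}, A_{6,i,j}`, the conditions `A_{1,i}w = 0`
(`w = Σ⁻¹b(0)`) and `b(t) − b(0) = o(Σᵢ tᵢ^{β′ᵢ})`, one has
`σ_b^{−2}(t) − σ_b^{−2}(0) = Σ_{i,j} Ξ_{i,j} tᵢ^{βᵢ/2}tⱼ^{βⱼ/2} + o(Σᵢ tᵢ^{βᵢ})`, where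
`Ξ_{i,j} = wᵀ[2A_{2,i}1_{i=j} + (A_{6,i,j} + A_{1,i}Σ⁻¹A_{1,j}ᵀ)1_{i,j∈F}]w`. -/
theorem stmt_12 {d n : ℕ} (hd : 1 ≤ d) (hn : 1 ≤ n)
    (Sfun : (Fin n → ℝ) → Matrix (Fin d) (Fin d) ℝ)
    (Sig : Matrix (Fin d) (Fin d) ℝ) (hSig0 : Sig = Sfun 0)
    (δ₀ : ℝ) (hδ₀ : 0 < δ₀)
    (hcont : ContinuousOn Sfun {t | ∀ i, 0 ≤ t i ∧ t i < δ₀})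
    (hpd : ∀ t : Fin n → ℝ, (∀ i, 0 ≤ t i ∧ t i < δ₀) → (Sfun t).PosDef)
    (β' β : Fin n → ℝ) (hβ'pos : ∀ i, 0 < β' i)
    (hββ' : ∀ i, β' i < β i ∧ β i ≤ 2 * β' i)
    (F : Finset (Fin n)) (hF : ∀ i, i ∈ F ↔ 2 * β' i = β i)
    (A1 A2 : Fin n → Matrix (Fin d) (Fin d) ℝ)
    (A6 : Fin n → Fin n → Matrix (Fin d) (Fin d) ℝ)
    (hexp : ∀ ε > (0 : ℝ), ∃ δ > (0 : ℝ), ∀ t : Fin n → ℝ,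
      (∀ i, 0 ≤ t i) → (∀ i, t i < δ) → ∀ p q : Fin d,
        |(Sig - Sfun t
            - (∑ i, ((t i ^ β' i) • (A1 i + (A1 i)ᵀ) + (t i ^ β i) • (A2 i + (A2 i)ᵀ))
               + ∑ i ∈ F, ∑ j ∈ F, (t i ^ (β i / 2) * t j ^ (β j / 2)) • A6 i j)
            : Matrix (Fin d) (Fin d) ℝ) p q|
          ≤ ε * ∑ i, t i ^ β i)
    (b : Fin d → ℝ) (hb : ∃ j, 0 < b j)
    (bt : (Fin n → ℝ) → (Fin d → ℝ))
    (hbfeas : ∀ t : Fin n → ℝ, (∀ i, 0 ≤ t i ∧ t i < δ₀) → b ≤ bt t)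
    (hbmin : ∀ t : Fin n → ℝ, (∀ i, 0 ≤ t i ∧ t i < δ₀) → ∀ x : Fin d → ℝ, b ≤ x →
      bt t ⬝ᵥ ((Sfun t)⁻¹ *ᵥ bt t) ≤ x ⬝ᵥ ((Sfun t)⁻¹ *ᵥ x))
    (w : Fin d → ℝ) (hw : w = Sig⁻¹ *ᵥ bt 0)
    (hA1w : ∀ i, A1 i *ᵥ w = 0)
    (hbt : ∀ ε > (0 : ℝ), ∃ δ > (0 : ℝ), ∀ t : Fin n → ℝ,
      (∀ i, 0 ≤ t i) → (∀ i, t i < δ) → ∀ j,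
        |bt t j - bt 0 j| ≤ ε * ∑ i, t i ^ β' i)
    (Ξ : Fin n → Fin n → ℝ)
    (hΞ : ∀ i j, Ξ i j =
      w ⬝ᵥ (((if i = j then (2 : ℝ) • A2 i else 0)
        + (if i ∈ F ∧ j ∈ F then A6 i j + A1 i * Sig⁻¹ * (A1 j)ᵀ else 0)) *ᵥ w)) :
    ∀ ε > (0 : ℝ), ∃ δ > (0 : ℝ), ∀ t : Fin n → ℝ,
      (∀ i, 0 ≤ t i) → (∀ i, t i < δ) →
        |bt t ⬝ᵥ ((Sfun t)⁻¹ *ᵥ bt t) - bt 0 ⬝ᵥ ((Sfun 0)⁻¹ *ᵥ bt 0)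
            - ∑ i, ∑ j, Ξ i j * t i ^ (β i / 2) * t j ^ (β j / 2)|
          ≤ ε * ∑ i, t i ^ β i := by
  set l : Filter (Fin n → ℝ) := 𝓝[{t | ∀ i, 0 ≤ t i}] 0 with hl
  set g : (Fin n → ℝ) → ℝ := fun t => ∑ i, t i ^ β i with hg
  set s : (Fin n → ℝ) → ℝ := fun t => √(g t) with hs
  have hβpos : ∀ i, 0 < β i := fun i => (hβ'pos i).trans (hββ' i).1
  have hnn : ∀ᶠ t in l, ∀ i, 0 ≤ t i := self_mem_nhdsWithin
  have hdom : ∀ᶠ t in l, ∀ i, 0 ≤ t i ∧ t i < δ₀ :=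
    eventually_nhdsWithin_orthant_iff.2 ⟨δ₀, hδ₀, fun t h0 h1 i => ⟨h0 i, h1 i⟩⟩
  have hsmall : ∀ᶠ t in l, ∀ i, 0 ≤ t i ∧ t i < 1 :=
    eventually_nhdsWithin_orthant_iff.2 ⟨1, one_pos, fun t h0 h1 i => ⟨h0 i, h1 i⟩⟩
  have hdom0 : ∀ i : Fin n, 0 ≤ (0 : Fin n → ℝ) i ∧ (0 : Fin n → ℝ) i < δ₀ :=
    fun i => ⟨le_rfl, hδ₀⟩
  have hgnn : ∀ t : Fin n → ℝ, (∀ i, 0 ≤ t i) → 0 ≤ g t := fun t ht =>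
    Finset.sum_nonneg fun i _ => rpow_nonneg (ht i) _
  have hcoord : ∀ i, Tendsto (fun t : Fin n → ℝ => t i) l (𝓝 0) := fun i =>
    ((continuous_apply i).tendsto (0 : Fin n → ℝ)).mono_left nhdsWithin_le_nhds
  have hpow : ∀ (i : Fin n) (a : ℝ), 0 < a →
      Tendsto (fun t : Fin n → ℝ => t i ^ a) l (𝓝 0) := fun i a ha => by
    simpa [zero_rpow ha.ne'] using (hcoord i).rpow_const (p := a) (Or.inr ha.le)
  have hg0 : Tendsto g l (𝓝 0) := by
    simpa using tendsto_finsetSum Finset.univ fun i _ => hpow i (β i) (hβpos i)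
  have hs0 : Tendsto s l (𝓝 0) := by simpa [hs] using hg0.sqrt
  have hs1 : s =o[l] fun _ => (1 : ℝ) := (isLittleO_one_iff ℝ).2 hs0
  have hss : (fun t => s t * s t) =ᶠ[l] g := by
    filter_upwards [hnn] with t ht using mul_self_sqrt (hgnn t ht)
  have hgs : g =o[l] s := by
    refine IsLittleO.congr' (f₁ := fun t => s t * s t) (g₁ := fun t => 1 * s t) ?_ hss
      (by simp)
    exact hs1.mul_isBigO (isBigO_refl _ _)
  have hβg : ∀ i, (fun t : Fin n → ℝ => t i ^ β i) =O[l] g := fun i => by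
    refine IsBigO.of_bound' ?_
    filter_upwards [hnn] with t ht
    rw [norm_of_nonneg (rpow_nonneg (ht i) _), norm_of_nonneg (hgnn t ht)]
    exact Finset.single_le_sum (f := fun i => t i ^ β i)
      (fun j _ => rpow_nonneg (ht j) _) (Finset.mem_univ i)
  have hrs : ∀ i, (fun t : Fin n → ℝ => t i ^ (β i / 2)) =O[l] s := fun i => by
    refine IsBigO.of_bound' ?_
    filter_upwards [hnn] with t ht
    rw [norm_of_nonneg (rpow_nonneg (ht i) _), norm_of_nonneg (sqrt_nonneg _)]
    refine le_sqrt_of_sq_le ?_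
    rw [← rpow_natCast, ← rpow_mul (ht i), Nat.cast_ofNat, div_mul_cancel₀ _ two_ne_zero]
    exact Finset.single_le_sum (f := fun i => t i ^ β i)
      (fun j _ => rpow_nonneg (ht j) _) (Finset.mem_univ i)
  have hrrg : ∀ i j, (fun t : Fin n → ℝ => t i ^ (β i / 2) * t j ^ (β j / 2)) =O[l] g :=
    fun i j => ((hrs i).mul (hrs j)).trans_eventuallyEq hss
  have husO : ∀ i, (fun t : Fin n → ℝ => t i ^ β' i) =O[l] s := fun i => by
    refine IsBigO.trans (IsBigO.of_bound' ?_) (hrs i)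
    filter_upwards [hsmall] with t ht
    rw [norm_of_nonneg (rpow_nonneg (ht i).1 _), norm_of_nonneg (rpow_nonneg (ht i).1 _)]
    exact rpow_le_rpow_of_exponent_ge' (ht i).1 (ht i).2.le (by linarith [hβpos i])
      (by linarith [(hββ' i).2])
  have huso : ∀ i, i ∉ F → (fun t : Fin n → ℝ => t i ^ β' i) =o[l] s := fun i hi => by
    have hlt : 0 < β' i - β i / 2 := by
      have := (hββ' i).2.lt_of_ne fun h => hi ((hF i).2 h.symm)
      linarith
    have h := ((isLittleO_one_iff ℝ).2 (hpow i _ hlt)).mul_isBigO (hrs i)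
    refine h.congr' ?_ (by simp)
    filter_upwards [hnn] with t ht
    rw [← rpow_add_of_nonneg (ht i) hlt.le (by linarith [hβpos i])]
    congr 1; ring
  have hF2 : ∀ i, i ∈ F → β' i = β i / 2 := fun i hi => by linarith [(hF i).1 hi]
  -- the matrices involved in the expansion of `Sfun`
  set M : (Fin n → ℝ) → Matrix (Fin d) (Fin d) ℝ := fun t =>
    ∑ i, (t i ^ β i) • (A2 i + (A2 i)ᵀ)
      + ∑ i ∈ F, ∑ j ∈ F, (t i ^ (β i / 2) * t j ^ (β j / 2)) • A6 i j with hM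
  set R : (Fin n → ℝ) → Matrix (Fin d) (Fin d) ℝ := fun t =>
    Sig - Sfun t
            - (∑ i, ((t i ^ β' i) • (A1 i + (A1 i)ᵀ) + (t i ^ β i) • (A2 i + (A2 i)ᵀ))
               + ∑ i ∈ F, ∑ j ∈ F, (t i ^ (β i / 2) * t j ^ (β j / 2)) • A6 i j) with hR
  set u : (Fin n → ℝ) → Fin d → ℝ := fun t => ∑ i, (t i ^ β' i) • ((A1 i)ᵀ *ᵥ w) with hu
  set z : (Fin n → ℝ) → Fin d → ℝ := fun t => (Sig - Sfun t) *ᵥ w with hz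
  have hRo : ∀ p q, (fun t => R t p q) =o[l] g := fun p q => by
    refine isLittleO_iff.2 fun ε hε => ?_
    obtain ⟨δ, hδ, h⟩ := hexp ε hε
    filter_upwards [eventually_nhdsWithin_orthant_iff.2 ⟨δ, hδ, h⟩, hnn] with t ht h0
    rw [norm_of_nonneg (hgnn t h0)]
    exact ht p q
  have hMO : ∀ p q, (fun t => M t p q) =O[l] g := fun p q => by
    simp only [hM, Matrix.add_apply, Matrix.sum_apply, Matrix.smul_apply, smul_eq_mul]
    refine IsBigO.add (IsBigO.fun_sum fun i _ => ?_)
      (IsBigO.fun_sum fun i _ => IsBigO.fun_sum fun j _ => ?_)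
    · simpa only [mul_comm, Matrix.add_apply] using (hβg i).const_mul_left ((A2 i + (A2 i)ᵀ) p q)
    · simpa only [mul_comm] using (hrrg i j).const_mul_left (A6 i j p q)
  have huO : ∀ p, (fun t => u t p) =O[l] s := fun p => by
    simp only [hu, Finset.sum_apply, Pi.smul_apply, smul_eq_mul]
    refine IsBigO.fun_sum fun i _ => ?_
    simpa only [mul_comm] using (husO i).const_mul_left (((A1 i)ᵀ *ᵥ w) p)
  have hdecomp : ∀ t, z t = u t + (M t *ᵥ w + R t *ᵥ w) := fun t => by
    have h1 : u t = (∑ i, (t i ^ β' i) • (A1 i + (A1 i)ᵀ)) *ᵥ w := by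
      simp only [hu, sum_mulVec, smul_mulVec, add_mulVec, hA1w, zero_add]
    rw [h1, ← add_mulVec, ← add_mulVec]
    simp only [hz, hM, hR, Finset.sum_add_distrib]
    congr 1
    abel
  have hzu : ∀ p, (fun t => (z t - u t) p) =o[l] s := fun p => by
    simp only [hdecomp, add_sub_cancel_left, Pi.add_apply]
    have hc : ∀ q, (fun _ : Fin n → ℝ => w q) =O[l] fun _ => (1 : ℝ) := fun q =>
      isBigO_const_const _ one_ne_zero _
    have h1 := isBigO_dotProduct (hMO p) hc
    have h2 := isLittleO_dotProduct_left (hRo p) hc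
    simp only [mul_one] at h1 h2
    exact (h1.trans_isLittleO hgs).add (h2.trans hgs)
  have hzO : ∀ p, (fun t => z t p) =O[l] s := fun p => by
    simpa using (hzu p).isBigO.add (huO p)
  -- the inverse matrices
  have hSpd : Sig.PosDef := hSig0 ▸ hpd 0 hdom0
  have hVt : Tendsto (fun t => (Sfun t)⁻¹) l (𝓝 Sig⁻¹) := by
    have h0 : Tendsto Sfun l (𝓝 Sig) := by
      rw [hSig0]
      have h := hcont 0 hdom0
      refine h.mono_left (le_inf nhdsWithin_le_nhds ?_)
      exact le_principal_iff.2 hdom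
    have hdet : Tendsto (fun t => (Sfun t).det) l (𝓝 Sig.det) :=
      ((continuous_id.matrix_det).tendsto Sig).comp h0
    have hadj : Tendsto (fun t => (Sfun t).adjugate) l (𝓝 Sig.adjugate) :=
      ((continuous_id.matrix_adjugate).tendsto Sig).comp h0
    simp only [Matrix.inv_def, Ring.inverse_eq_inv']
    exact (hdet.inv₀ hSpd.det_pos.ne').smul hadj
  have hVe : ∀ p q, Tendsto (fun t => (Sfun t)⁻¹ p q) l (𝓝 (Sig⁻¹ p q)) := fun p q =>
    tendsto_pi_nhds.1 (tendsto_pi_nhds.1 hVt p) q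
  have hVO : ∀ p q, (fun t => (Sfun t)⁻¹ p q) =O[l] fun _ => (1 : ℝ) := fun p q =>
    (hVe p q).isBigO_one ℝ
  have hVo : ∀ p q, (fun t => ((Sfun t)⁻¹ - Sig⁻¹) p q) =o[l] fun _ => (1 : ℝ) := fun p q => by
    rw [isLittleO_one_iff]
    simpa using (hVe p q).sub_const (Sig⁻¹ p q)
  have hSO : ∀ p q, (fun _ : Fin n → ℝ => Sig⁻¹ p q) =O[l] fun _ => (1 : ℝ) := fun p q =>
    isBigO_const_const _ one_ne_zero _
  -- the displacement of the minimizer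
  have heo : ∀ p, (fun t => (bt t - bt 0) p) =o[l] s := fun p => by
    have h1 : (fun t => (bt t - bt 0) p) =o[l] fun t : Fin n → ℝ => ∑ i, t i ^ β' i := by
      refine isLittleO_iff.2 fun ε hε => ?_
      obtain ⟨δ, hδ, h⟩ := hbt ε hε
      filter_upwards [eventually_nhdsWithin_orthant_iff.2 ⟨δ, hδ, h⟩, hnn] with t ht h0
      rw [norm_of_nonneg (Finset.sum_nonneg fun i _ => rpow_nonneg (h0 i) _)]
      exact ht p
    exact h1.trans_isBigO (IsBigO.fun_sum fun i _ => husO i)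
  have hmin_part : (fun t => bt t ⬝ᵥ ((Sfun t)⁻¹ *ᵥ bt t) - bt 0 ⬝ᵥ ((Sfun t)⁻¹ *ᵥ bt 0))
      =o[l] g := by
    have h1 : (fun t => 2 * ((bt t - bt 0) ⬝ᵥ ((Sfun t)⁻¹ *ᵥ z t))) =o[l] g :=
      ((isLittleO_dotProduct_left heo (isBigO_mulVec hVO hzO)).trans_eventuallyEq
        hss).const_mul_left 2
    refine IsBigO.trans_isLittleO (IsBigO.of_bound' ?_) h1
    filter_upwards [hdom] with t ht
    have hTpd := hpd t ht
    have hle := hbmin t ht (bt 0) (hbfeas 0 hdom0)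
    have hvar : 0 ≤ (bt t - bt 0) ⬝ᵥ w := by
      rw [hw, hSig0]
      exact dotProduct_mulVec_sub_nonneg_of_isMin (hpd 0 hdom0).inv.isSymm_real
        (hbfeas 0 hdom0) (hbmin 0 hdom0) (hbfeas t ht)
    have hVb := (dotProduct_inv_mulVec_eq_add hSpd hTpd (bt 0) w hw).1
    have hpos := hTpd.dotProduct_inv_mulVec_nonneg (bt t - bt 0)
    have hsplit : (bt t - bt 0) ⬝ᵥ ((Sfun t)⁻¹ *ᵥ bt 0)
        = (bt t - bt 0) ⬝ᵥ w + (bt t - bt 0) ⬝ᵥ ((Sfun t)⁻¹ *ᵥ z t) := by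
      rw [hVb, dotProduct_add]
    have hquad : (bt t - bt 0) ⬝ᵥ ((Sfun t)⁻¹ *ᵥ (bt t - bt 0))
        = bt t ⬝ᵥ ((Sfun t)⁻¹ *ᵥ bt t) - bt 0 ⬝ᵥ ((Sfun t)⁻¹ *ᵥ bt 0)
          - 2 * ((bt t - bt 0) ⬝ᵥ ((Sfun t)⁻¹ *ᵥ bt 0)) := by
      have hsym := hTpd.inv.isSymm_real.dotProduct_mulVec_comm (bt t) (bt 0)
      simp only [mulVec_sub, sub_dotProduct, dotProduct_sub]
      linarith
    rw [Real.norm_eq_abs, Real.norm_eq_abs, abs_of_nonpos (by linarith)]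
    refine le_trans ?_ (neg_le_abs _)
    linarith
  -- the first order term
  set Q₁ : (Fin n → ℝ) → ℝ := fun t => w ⬝ᵥ (M t *ᵥ w) with hQ₁
  have hlin_part : (fun t => w ⬝ᵥ z t - Q₁ t) =o[l] g := by
    have hc : ∀ q, (fun _ : Fin n → ℝ => w q) =O[l] fun _ => (1 : ℝ) := fun q =>
      isBigO_const_const _ one_ne_zero _
    have hwR : (fun t => w ⬝ᵥ (R t *ᵥ w)) =o[l] g := by
      have h2 : ∀ p, (fun t => (R t *ᵥ w) p) =o[l] g := fun p => by
        simpa only [mul_one, mulVec] using isLittleO_dotProduct_left (hRo p) hc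
      simpa only [one_mul] using isLittleO_dotProduct_right hc h2
    refine hwR.congr_left fun t => ?_
    have hwu : w ⬝ᵥ u t = 0 := by
      simp only [hu, dotProduct_sum, dotProduct_smul]
      refine Finset.sum_eq_zero fun i _ => ?_
      rw [dotProduct_mulVec, vecMul_transpose, hA1w, zero_dotProduct, smul_zero]
    rw [hdecomp t, dotProduct_add, dotProduct_add, hwu]
    simp only [hQ₁]
    ring
  -- the second order term
  set Q₂ : (Fin n → ℝ) → ℝ := fun t => ∑ i, ∑ j,
    (if i ∈ F ∧ j ∈ F then w ⬝ᵥ ((A1 i * Sig⁻¹ * (A1 j)ᵀ) *ᵥ w) else 0)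
      * t i ^ (β i / 2) * t j ^ (β j / 2) with hQ₂
  have hquad_part : (fun t => z t ⬝ᵥ ((Sfun t)⁻¹ *ᵥ z t) - Q₂ t) =o[l] g := by
    have h1 : (fun t => z t ⬝ᵥ (((Sfun t)⁻¹ - Sig⁻¹) *ᵥ z t)) =o[l] g :=
      (isLittleO_dotProduct_right hzO (isLittleO_mulVec_of_left hVo hzO)).trans_eventuallyEq hss
    have h2 : (fun t => (z t - u t) ⬝ᵥ (Sig⁻¹ *ᵥ z t)) =o[l] g :=
      (isLittleO_dotProduct_left hzu (isBigO_mulVec hSO hzO)).trans_eventuallyEq hss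
    have h3 : (fun t => u t ⬝ᵥ (Sig⁻¹ *ᵥ (z t - u t))) =o[l] g :=
      (isLittleO_dotProduct_right huO (isLittleO_mulVec_of_right hSO hzu)).trans_eventuallyEq hss
    have h4 : (fun t => u t ⬝ᵥ (Sig⁻¹ *ᵥ u t) - Q₂ t) =o[l] g := by
      have hterm : ∀ i j, (fun t : Fin n → ℝ =>
          w ⬝ᵥ ((A1 i * Sig⁻¹ * (A1 j)ᵀ) *ᵥ w) * (t i ^ β' i * t j ^ β' j)
          - (if i ∈ F ∧ j ∈ F then w ⬝ᵥ ((A1 i * Sig⁻¹ * (A1 j)ᵀ) *ᵥ w) else 0)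
            * t i ^ (β i / 2) * t j ^ (β j / 2)) =o[l] g := fun i j => by
        by_cases hi : i ∈ F
        · by_cases hj : j ∈ F
          · simp only [hi, hj, and_self, if_true, hF2 i hi, hF2 j hj, mul_assoc, sub_self]
            exact isLittleO_zero _ _
          · simp only [hj, and_false, if_false, zero_mul, sub_zero]
            exact (((husO i).mul_isLittleO (huso j hj)).trans_eventuallyEq
              hss).const_mul_left _
        · simp only [hi, false_and, if_false, zero_mul, sub_zero]
          exact (((huso i hi).mul_isBigO (husO j)).trans_eventuallyEq hss).const_mul_left _
      refine (IsLittleO.fun_sum (s := Finset.univ) fun i _ =>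
        IsLittleO.fun_sum (s := Finset.univ) fun j _ => hterm i j).congr_left fun t => ?_
      simp only [hQ₂, Finset.sum_sub_distrib]
      congr 1
      simp only [hu, mulVec_sum, sum_dotProduct, dotProduct_sum, mulVec_smul, smul_dotProduct,
        dotProduct_smul, smul_eq_mul]
      rw [Finset.sum_comm]
      simp only [Finset.mul_sum]
      refine Finset.sum_congr rfl fun i _ => Finset.sum_congr rfl fun j _ => ?_
      rw [← mulVec_mulVec, ← mulVec_mulVec, dotProduct_mulVec w (A1 j), ← mulVec_transpose]
      ring
    refine (((h1.add h2).add h3).add h4).congr_left fun t => ?_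
    simp only [sub_mulVec, mulVec_sub, dotProduct_sub, sub_dotProduct]
    ring
  have hΞsum : ∀ t : Fin n → ℝ, (∀ i, 0 ≤ t i) →
      ∑ i, ∑ j, Ξ i j * t i ^ (β i / 2) * t j ^ (β j / 2) = Q₁ t + Q₂ t := fun t ht => by
    have hsq : ∀ i, t i ^ (β i / 2) * t i ^ (β i / 2) = t i ^ β i := fun i => by
      have := (hβpos i).le
      rw [← rpow_add_of_nonneg (ht i) (by linarith) (by linarith), add_halves]
    have hA2 : ∑ i, ∑ j, (if i = j then 2 * (w ⬝ᵥ (A2 i *ᵥ w)) else 0)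
        * t i ^ (β i / 2) * t j ^ (β j / 2) = ∑ i, t i ^ β i * (w ⬝ᵥ ((A2 i + (A2 i)ᵀ) *ᵥ w)) := by
      refine Finset.sum_congr rfl fun i _ => ?_
      have hT : w ⬝ᵥ ((A2 i)ᵀ *ᵥ w) = w ⬝ᵥ (A2 i *ᵥ w) := by
        rw [mulVec_transpose, dotProduct_comm, ← dotProduct_mulVec]
      simp only [ite_mul, zero_mul, Finset.sum_ite_eq, Finset.mem_univ, if_true]
      rw [add_mulVec, dotProduct_add, hT, mul_assoc, hsq]
      ring
    have hA6 : ∑ i, ∑ j, (if i ∈ F ∧ j ∈ F then w ⬝ᵥ (A6 i j *ᵥ w) else 0)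
        * t i ^ (β i / 2) * t j ^ (β j / 2)
        = ∑ i ∈ F, ∑ j ∈ F, t i ^ (β i / 2) * t j ^ (β j / 2) * (w ⬝ᵥ (A6 i j *ᵥ w)) := by
      rw [← Finset.sum_subset (Finset.subset_univ F) fun i _ hi => by simp [hi]]
      refine Finset.sum_congr rfl fun i hi => ?_
      rw [← Finset.sum_subset (Finset.subset_univ F) fun j _ hj => by simp [hj]]
      refine Finset.sum_congr rfl fun j hj => ?_
      rw [if_pos ⟨hi, hj⟩]
      ring
    have hQ₁t : Q₁ t = ∑ i, t i ^ β i * (w ⬝ᵥ ((A2 i + (A2 i)ᵀ) *ᵥ w))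
        + ∑ i ∈ F, ∑ j ∈ F, t i ^ (β i / 2) * t j ^ (β j / 2) * (w ⬝ᵥ (A6 i j *ᵥ w)) := by
      simp only [hQ₁, hM, add_mulVec _ _ w, sum_mulVec, smul_mulVec, dotProduct_add,
        dotProduct_sum, dotProduct_smul, smul_eq_mul]
    rw [hQ₁t, ← hA2, ← hA6]
    simp only [hQ₂, ← Finset.sum_add_distrib]
    refine Finset.sum_congr rfl fun i _ => Finset.sum_congr rfl fun j _ => ?_
    rw [hΞ]
    split_ifs <;>
      simp only [add_mulVec, smul_mulVec, zero_mulVec, dotProduct_add, dotProduct_smul,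
        dotProduct_zero, smul_eq_mul] <;> ring
  have hmain : (fun t => bt t ⬝ᵥ ((Sfun t)⁻¹ *ᵥ bt t) - bt 0 ⬝ᵥ ((Sfun 0)⁻¹ *ᵥ bt 0)
      - ∑ i, ∑ j, Ξ i j * t i ^ (β i / 2) * t j ^ (β j / 2)) =o[l] g := by
    refine ((hmin_part.add hlin_part).add hquad_part).congr' ?_ EventuallyEq.rfl
    filter_upwards [hdom] with t ht
    have h := (dotProduct_inv_mulVec_eq_add hSpd (hpd t ht) (bt 0) w hw).2
    rw [hΞsum t fun i => (ht i).1, ← hSig0]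
    linarith
  intro ε hε
  refine eventually_nhdsWithin_orthant_iff.1 ?_
  filter_upwards [isLittleO_iff.1 hmain hε, hnn] with t ht h0
  rwa [norm_of_nonneg (hgnn t h0), Real.norm_eq_abs] at ht
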